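/- Causal influence is not transitive: consider three qubits A, B, C with joint space ℂ⁸ indexed by (i,k,m) ∈ [2]³, let V₁ be the unitary V₁|i,k,m⟩ = |i⊕k, k, m⟩ (CNOT with B control and A target, identity on C), and V₂ the unitary V₂|i,k,m⟩ = |i, k, m⊕k⟩ (CNOT with B control and C target, identity on A). Then (1) there exist density matrices ρ^A, ρ̃^A, ρ^B, ρ^C on ℂ² such that the reduced states of B after V₁ differ: Tr_{AC}[V₁(ρ^A⊗ρ^B⊗ρ^C)V₁†] ≠ Tr_{AC}[V₁(ρ̃^A⊗ρ^B⊗ρ^C)V₁†]; (2) there exist density matrices ρ^A, ρ^B, ρ̃^B, ρ^C such that Tr_{AB}[V₂(ρ^A⊗ρ^B⊗ρ^C)V₂†] ≠ Tr_{AB}[V₂(ρ^A⊗ρ̃^B⊗ρ^C)V₂†]; but (3) for all density matrices ρ^A, ρ̃^A, ρ^B, ρ^C one has Tr_{AB}[V₂V₁(ρ^A⊗ρ^B⊗ρ^C)(V₂V₁)†] = Tr_{AB}[V₂V₁(ρ̃^A⊗ρ^B⊗ρ^C)(V₂V₁)†], i.e. A does not causally influence C under the composite evolution. -/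

import Mathlib

open Matrix
open scoped ComplexConjugate ComplexOrder

noncomputable section

/-- A density matrix on `ℂ^d`: positive semidefinite with trace 1. -/
def IsDensity {d : ℕ} (ρ : Matrix (Fin d) (Fin d) ℂ) : Prop :=
  ρ.PosSemidef ∧ ρ.trace = 1

/-- Kronecker product of three 2×2 matrices, indexed by triples. -/
def kron3 (ρA ρB ρC : Matrix (Fin 2) (Fin 2) ℂ) :
    Matrix (Fin 2 × Fin 2 × Fin 2) (Fin 2 × Fin 2 × Fin 2) ℂ :=
  Matrix.of fun p q => ρA p.1 q.1 * ρB p.2.1 q.2.1 * ρC p.2.2 q.2.2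

/-- `V₁|i,k,m⟩ = |i⊕k, k, m⟩`: CNOT with `B` control and `A` target, identity on `C`. -/
def V1 : Matrix (Fin 2 × Fin 2 × Fin 2) (Fin 2 × Fin 2 × Fin 2) ℂ :=
  Matrix.of fun p q =>
    if p.1 = q.1 + q.2.1 ∧ p.2.1 = q.2.1 ∧ p.2.2 = q.2.2 then 1 else 0

/-- `V₂|i,k,m⟩ = |i, k, m⊕k⟩`: CNOT with `B` control and `C` target, identity on `A`. -/
def V2 : Matrix (Fin 2 × Fin 2 × Fin 2) (Fin 2 × Fin 2 × Fin 2) ℂ :=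
  Matrix.of fun p q =>
    if p.1 = q.1 ∧ p.2.1 = q.2.1 ∧ p.2.2 = q.2.2 + q.2.1 then 1 else 0

/-- Partial trace over `A` and `C`. -/
def trAC (M : Matrix (Fin 2 × Fin 2 × Fin 2) (Fin 2 × Fin 2 × Fin 2) ℂ) :
    Matrix (Fin 2) (Fin 2) ℂ :=
  Matrix.of fun k' l' => ∑ i' : Fin 2, ∑ m' : Fin 2, M (i', k', m') (i', l', m')

/-- Partial trace over `A` and `B`. -/
def trAB (M : Matrix (Fin 2 × Fin 2 × Fin 2) (Fin 2 × Fin 2 × Fin 2) ℂ) :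
    Matrix (Fin 2) (Fin 2) ℂ :=
  Matrix.of fun m' n' => ∑ i' : Fin 2, ∑ k' : Fin 2, M (i', k', m') (i', k', n')

/-- Conjugation by the matrix of a map of basis labels relabels the matrix entries. -/
theorem mul_mul_conjTranspose_eq_submatrix {n : Type*} [Fintype n] [DecidableEq n]
    {V : Matrix n n ℂ} {f : n → n} (hV : ∀ p q, V p q = if f p = q then 1 else 0)
    (M : Matrix n n ℂ) :
    V * M * Vᴴ = M.submatrix f f := by
  ext p q
  simp [Matrix.mul_apply, hV, apply_ite (starRingEnd ℂ)]

/-- The action of `V1` on basis labels. -/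
def flipA (p : Fin 2 × Fin 2 × Fin 2) : Fin 2 × Fin 2 × Fin 2 :=
  (p.1 + p.2.1, p.2.1, p.2.2)

/-- The action of `V2` on basis labels. -/
def flipC (p : Fin 2 × Fin 2 × Fin 2) : Fin 2 × Fin 2 × Fin 2 :=
  (p.1, p.2.1, p.2.2 + p.2.1)

theorem V1_conj (M : Matrix (Fin 2 × Fin 2 × Fin 2) (Fin 2 × Fin 2 × Fin 2) ℂ) :
    V1 * M * V1ᴴ = M.submatrix flipA flipA := by
  refine mul_mul_conjTranspose_eq_submatrix (fun p q => ?_) M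
  have h : ∀ p q : Fin 2 × Fin 2 × Fin 2,
      (p.1 = q.1 + q.2.1 ∧ p.2.1 = q.2.1 ∧ p.2.2 = q.2.2) ↔ flipA p = q := by decide
  simp [V1, h]

theorem V2_conj (M : Matrix (Fin 2 × Fin 2 × Fin 2) (Fin 2 × Fin 2 × Fin 2) ℂ) :
    V2 * M * V2ᴴ = M.submatrix flipC flipC := by
  refine mul_mul_conjTranspose_eq_submatrix (fun p q => ?_) M
  have h : ∀ p q : Fin 2 × Fin 2 × Fin 2,
      (p.1 = q.1 ∧ p.2.1 = q.2.1 ∧ p.2.2 = q.2.2 + q.2.1) ↔ flipC p = q := by decide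
  simp [V2, h]

theorem V2_mul_V1_conj (M : Matrix (Fin 2 × Fin 2 × Fin 2) (Fin 2 × Fin 2 × Fin 2) ℂ) :
    (V2 * V1) * M * (V2 * V1)ᴴ = (M.submatrix flipA flipA).submatrix flipC flipC := by
  rw [← V1_conj, ← V2_conj, conjTranspose_mul]
  simp only [Matrix.mul_assoc]

/-- The basis state `|j⟩⟨j|`. -/
def basisState (j : Fin 2) : Matrix (Fin 2) (Fin 2) ℂ :=
  Matrix.diagonal (Pi.single j 1)

/-- The state `|+⟩⟨+|`, with `|+⟩ = (|0⟩ + |1⟩)/√2`. -/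
def plusState : Matrix (Fin 2) (Fin 2) ℂ :=
  Matrix.of fun _ _ => 1 / 2

theorem isDensity_basisState (j : Fin 2) : IsDensity (basisState j) := by
  refine ⟨PosSemidef.diagonal (Pi.single_nonneg.2 zero_le_one), ?_⟩
  simp [basisState]

theorem isDensity_plusState : IsDensity plusState := by
  constructor
  · have h : plusState = (1 / 2 : ℂ) • vecMulVec (1 : Fin 2 → ℂ) (star 1) := by
      ext i j
      simp [plusState]
    rw [h]
    exact (posSemidef_vecMulVec_self_star _).smul (by positivity)
  · norm_num [plusState, trace_fin_two]

/-- Causal influence is not transitive: `A → B` under `V₁`, `B → C` under `V₂`, but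
`A ↛ C` under the composite evolution `V₂V₁`. -/
theorem stmt_11 :
    (∃ ρA ρA' ρB ρC : Matrix (Fin 2) (Fin 2) ℂ,
      IsDensity ρA ∧ IsDensity ρA' ∧ IsDensity ρB ∧ IsDensity ρC ∧
      trAC (V1 * kron3 ρA ρB ρC * V1ᴴ) ≠ trAC (V1 * kron3 ρA' ρB ρC * V1ᴴ)) ∧
    (∃ ρA ρB ρB' ρC : Matrix (Fin 2) (Fin 2) ℂ,
      IsDensity ρA ∧ IsDensity ρB ∧ IsDensity ρB' ∧ IsDensity ρC ∧
      trAB (V2 * kron3 ρA ρB ρC * V2ᴴ) ≠ trAB (V2 * kron3 ρA ρB' ρC * V2ᴴ)) ∧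
    (∀ ρA ρA' ρB ρC : Matrix (Fin 2) (Fin 2) ℂ,
      IsDensity ρA → IsDensity ρA' → IsDensity ρB → IsDensity ρC →
      trAB ((V2 * V1) * kron3 ρA ρB ρC * (V2 * V1)ᴴ) =
        trAB ((V2 * V1) * kron3 ρA' ρB ρC * (V2 * V1)ᴴ)) := by
  refine ⟨⟨plusState, basisState 0, plusState, basisState 0, isDensity_plusState,
    isDensity_basisState 0, isDensity_plusState, isDensity_basisState 0, fun h => ?_⟩,
    ⟨basisState 0, basisState 0, basisState 1, basisState 0, isDensity_basisState 0,
    isDensity_basisState 0, isDensity_basisState 1, isDensity_basisState 0, fun h => ?_⟩,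
    fun ρA ρA' ρB ρC hA hA' _ _ => ?_⟩
  · rw [V1_conj, V1_conj] at h
    simpa [trAC, flipA, kron3, plusState, basisState] using congrFun₂ h 0 1
  · rw [V2_conj, V2_conj] at h
    simpa [trAB, flipC, kron3, basisState] using congrFun₂ h 0 0
  · have h : ρA 0 0 + ρA 1 1 = ρA' 0 0 + ρA' 1 1 := by
      rw [← trace_fin_two, ← trace_fin_two, hA.2, hA'.2]
    rw [V2_mul_V1_conj, V2_mul_V1_conj]
    ext m n
    simp only [trAB, flipA, flipC, kron3, of_apply, submatrix_apply, Fin.sum_univ_two,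
      add_zero, zero_add, show (1 + 1 : Fin 2) = 0 from rfl]
    linear_combination (ρB 0 0 * ρC m n + ρB 1 1 * ρC (m + 1) (n + 1)) * h

end
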